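/- For every s ≥ 2, identifying Λ_s with the ring ℤ/sℤ, the semigroup LCAT(Λ_s^ℕ) of all linear cellular automaton transformations is maximal commutative in CAT(Λ_s^ℕ). -/

import Mathlib

/-- The left shift on one-sided sequences over the alphabet `A`. -/
def shiftN (A : Type) : (ℕ → A) → (ℕ → A) := fun a k => a (k + 1)

/-- A cellular automaton transformation of the one-sided full shift over `A`:
a continuous map commuting with the left shift. -/
def IsCAT (A : Type) [TopologicalSpace A] (τ : (ℕ → A) → (ℕ → A)) : Prop :=
  Continuous τ ∧ τ ∘ shiftN A = shiftN A ∘ τ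

/-- The semigroup `CAT(Λ^ℕ)` of all cellular automaton transformations. -/
def CATset (A : Type) [TopologicalSpace A] : Set ((ℕ → A) → (ℕ → A)) := {τ | IsCAT A τ}

/-- `S` is a maximal commutative subsemigroup of `CAT`: it consists of elements of `CAT`,
it is commutative, and every element of `CAT` commuting with all of `S` lies in `S`. -/
def IsMC {Ω : Type} (CAT S : Set (Ω → Ω)) : Prop :=
  S ⊆ CAT ∧ (∀ τ ∈ S, ∀ μ ∈ S, τ ∘ μ = μ ∘ τ) ∧
    ∀ μ ∈ CAT, (∀ τ ∈ S, μ ∘ τ = τ ∘ μ) → μ ∈ S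

/-- A continuous map into a discrete space is constant on a cylinder around each point. -/
lemma exists_prefix_determines {A B : Type} [TopologicalSpace A] [DiscreteTopology A]
    [TopologicalSpace B] [DiscreteTopology B] {g : (ℕ → A) → B} (hg : Continuous g) (x : ℕ → A) :
    ∃ N, ∀ n, N ≤ n → ∀ y : ℕ → A, (∀ i < n, y i = x i) → g y = g x := by
  have hopen : IsOpen (g ⁻¹' {g x}) := (isOpen_discrete _).preimage hg
  obtain ⟨v, ⟨z, N, rfl⟩, hx, hsub⟩ :=
    (PiNat.isTopologicalBasis_cylinders (fun _ : ℕ => A)).exists_subset_of_mem_open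
      (show x ∈ g ⁻¹' {g x} from rfl) hopen
  exact ⟨N, fun n hn y hy => hsub fun i hi => (hy i (hi.trans_le hn)).trans (hx i hi)⟩

lemma shiftN_iterate_apply (A : Type) (j : ℕ) (x : ℕ → A) (k : ℕ) :
    (shiftN A)^[j] x k = x (k + j) := by
  induction j generalizing x with
  | zero => rfl
  | succ j ih => rw [Function.iterate_succ_apply, ih]; rfl

namespace IsCAT

section

variable {A : Type} [TopologicalSpace A] {τ : (ℕ → A) → (ℕ → A)}

lemma map_shiftN_iterate (h : IsCAT A τ) (j : ℕ) (x : ℕ → A) :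
    τ ((shiftN A)^[j] x) = (shiftN A)^[j] (τ x) := by
  have hc : Function.Commute τ (shiftN A) := congrFun h.2
  exact hc.iterate_right j x

lemma apply_eq (h : IsCAT A τ) (x : ℕ → A) (n : ℕ) : τ x n = τ ((shiftN A)^[n] x) 0 := by
  rw [h.map_shiftN_iterate, shiftN_iterate_apply, zero_add]

lemma continuous_apply_zero (h : IsCAT A τ) : Continuous fun x => τ x 0 :=
  (continuous_apply 0).comp h.1

end

variable {R : Type} [CommRing R] [TopologicalSpace R] [DiscreteTopology R]

/-- A linear cellular automaton is a polynomial in the shift. -/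
lemma exists_eq_sum_shiftN {τ : (ℕ → R) → (ℕ → R)} (h : IsCAT R τ) (hl : IsLinearMap R τ) :
    ∃ (N : ℕ) (c : ℕ → R), ∀ x, τ x = ∑ j ∈ Finset.range N, c j • (shiftN R)^[j] x := by
  obtain ⟨N, hN⟩ := exists_prefix_determines h.continuous_apply_zero 0
  let T : (ℕ → R) →ₗ[R] R := LinearMap.proj 0 ∘ₗ hl.mk' τ
  refine ⟨N, fun j => T (Pi.single j 1), fun x => funext fun k => ?_⟩
  rw [h.apply_eq]
  set y := (shiftN R)^[k] x with hy
  have hzero : T (y - ∑ j ∈ Finset.range N, y j • Pi.single j 1) = T 0 := by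
    refine hN N le_rfl _ fun i hi => ?_
    simp [Finset.sum_apply, Pi.single_apply, hi]
  rw [map_zero, map_sub, sub_eq_zero] at hzero
  change T y = _
  rw [hzero, map_sum, Finset.sum_apply]
  refine Finset.sum_congr rfl fun j _ => ?_
  simp only [map_smul, Pi.smul_apply, hy, shiftN_iterate_apply, smul_eq_mul]
  rw [add_comm j k, mul_comm]

/-- A cellular automaton commuting with all `1 + σ ^ N` is additive: for large `N`, apply `1 + σ ^ N`
to a sequence with the prefix of `a` at position `0` followed by `b` at position `N`. -/
lemma map_add_of_commute {μ : (ℕ → R) → (ℕ → R)} (h : IsCAT R μ)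
    (hc : ∀ N x, μ (x + (shiftN R)^[N] x) = μ x + (shiftN R)^[N] (μ x)) (a b : ℕ → R) :
    μ (a + b) = μ a + μ b := by
  have key (a b : ℕ → R) : μ (a + b) 0 = μ a 0 + μ b 0 := by
    obtain ⟨N₁, h₁⟩ := exists_prefix_determines h.continuous_apply_zero a
    obtain ⟨N₂, h₂⟩ := exists_prefix_determines h.continuous_apply_zero (a + b)
    let N := max N₁ N₂
    let x : ℕ → R := fun i => if i < N then a i else b (i - N)
    have hxa : μ x 0 = μ a 0 := h₁ N (le_max_left _ _) x fun i hi => if_pos hi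
    have hxb : (shiftN R)^[N] x = b := by
      funext i
      simp [shiftN_iterate_apply, x]
    have hsum : μ (x + b) 0 = μ (a + b) 0 :=
      h₂ N (le_max_right _ _) (x + b) fun i hi => by simp [x, hi]
    have hcomm := congrFun (hc N x) 0
    rw [← h.map_shiftN_iterate, hxb, hsum, Pi.add_apply, hxa] at hcomm
    exact hcomm
  funext n
  have hadd : (shiftN R)^[n] (a + b) = (shiftN R)^[n] a + (shiftN R)^[n] b := by
    funext k
    simp [shiftN_iterate_apply]
  rw [Pi.add_apply, h.apply_eq, h.apply_eq a, h.apply_eq b, hadd, key]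

end IsCAT

lemma isCAT_add_shiftN_iterate (R : Type) [CommRing R] [TopologicalSpace R] [ContinuousAdd R]
    (N : ℕ) : IsCAT R fun x => x + (shiftN R)^[N] x := by
  refine ⟨continuous_pi fun k => ?_, ?_⟩
  · simp only [Pi.add_apply, shiftN_iterate_apply]
    fun_prop
  · funext x k
    simp [shiftN_iterate_apply, shiftN, add_right_comm]

lemma isLinearMap_add_shiftN_iterate (R : Type) [CommRing R] (N : ℕ) :
    IsLinearMap R fun x : ℕ → R => x + (shiftN R)^[N] x where
  map_add x y := by
    funext k
    simp only [Pi.add_apply, shiftN_iterate_apply]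
    ring
  map_smul c x := by
    funext k
    simp only [Pi.add_apply, Pi.smul_apply, shiftN_iterate_apply, smul_add]

/-- For every `s ≥ 2`, identifying `Λ_s` with the ring `ℤ/sℤ`, the
semigroup `LCAT(Λ_s^ℕ)` of all `ℤ/sℤ`-linear cellular automaton transformations is
maximal commutative in `CAT(Λ_s^ℕ)`. -/
theorem LCAT_ZMod_MC (s : ℕ) (hs : 2 ≤ s) :
    IsMC (CATset (ZMod s))
      {τ : (ℕ → ZMod s) → (ℕ → ZMod s) | IsCAT (ZMod s) τ ∧ IsLinearMap (ZMod s) τ} := by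
  refine ⟨fun τ hτ => hτ.1, fun τ hτ μ hμ => funext fun x => ?_, fun μ hμ hc => ⟨hμ, ?_⟩⟩
  · obtain ⟨N, c, hsum⟩ := hτ.1.exists_eq_sum_shiftN hτ.2
    change τ (μ x) = hμ.2.mk' μ (τ x)
    rw [hsum x, map_sum, hsum]
    refine Finset.sum_congr rfl fun j _ => ?_
    rw [map_smul, IsLinearMap.mk'_apply, hμ.1.map_shiftN_iterate]
  · have hadd := hμ.map_add_of_commute fun N => congrFun
      (hc _ ⟨isCAT_add_shiftN_iterate (ZMod s) N, isLinearMap_add_shiftN_iterate (ZMod s) N⟩)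
    exact ((AddMonoidHom.mk' μ hadd).toZModLinearMap s).isLinear
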